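/- Let p be a sequence model on V and ξ > 0 with p s eos ≥ ξ for every prefix s : List V. Let S : List V → Finset V be any prefix-dependent candidate-set function with eos ∈ S s for every s, and define q by q s v = p s v / ∑_{w ∈ S s} p s w for v ∈ S s and q s v = 0 otherwise. Then q is a sequence model with q s eos ≥ p s eos for every s, and NT_q(t) ≤ (1 − ξ)^t for every t, so NT_q(t) → 0 as t → ∞; that is, consistent top-k sampling and consistent nucleus sampling are consistent with respect to any consistent model. -/

import Mathlib

open Finset Filter

/-- Non-termination mass of a sequence model at horizon `t`. -/
noncomputable def NT {V : Type*} [Fintype V] [DecidableEq V]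
    (p : List V → V → ℝ) (eos : V) (t : ℕ) : ℝ :=
  ∑ y ∈ Finset.univ.filter (fun y : Fin t → V => ∀ i, y i ≠ eos),
    ∏ i : Fin t, p ((List.ofFn y).take i) (y i)

theorem NT_succ {V : Type*} [Fintype V] [DecidableEq V]
    (p : List V → V → ℝ) (eos : V) (t : ℕ) :
    NT p eos (t + 1) = ∑ v ∈ Finset.univ.erase eos, p [] v * NT (fun s => p (v :: s)) eos t := by
  simp only [NT, Finset.mul_sum]
  rw [Finset.sum_sigma']
  refine Finset.sum_bij' (fun y _ => ⟨y 0, Fin.tail y⟩) (fun z _ => Fin.cons z.1 z.2) ?_ ?_ ?_ ?_ ?_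
  · intro y hy
    simp only [mem_filter, mem_univ, true_and] at hy
    simpa [Fin.tail, hy 0] using fun i : Fin t => hy i.succ
  · rintro ⟨v, y⟩ h
    simpa [Fin.forall_fin_succ] using h
  · simp
  · simp
  · intro y _
    simp [Fin.prod_univ_succ, Fin.tail_def]

theorem NT_nonneg {V : Type*} [Fintype V] [DecidableEq V]
    {p : List V → V → ℝ} (hp : ∀ s v, 0 ≤ p s v) (eos : V) (t : ℕ) : 0 ≤ NT p eos t :=
  Finset.sum_nonneg fun _ _ => Finset.prod_nonneg fun _ _ => hp _ _

theorem NT_le_pow {V : Type*} [Fintype V] [DecidableEq V]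
    {p : List V → V → ℝ} {eos : V} {c : ℝ} (hp : ∀ s v, 0 ≤ p s v)
    (hc : ∀ s, ∑ v ∈ Finset.univ.erase eos, p s v ≤ c) (t : ℕ) : NT p eos t ≤ c ^ t := by
  induction t generalizing p with
  | zero => simp [NT]
  | succ t ih =>
    have hc0 : 0 ≤ c := (Finset.sum_nonneg fun v _ => hp [] v).trans (hc [])
    calc NT p eos (t + 1)
        = ∑ v ∈ Finset.univ.erase eos, p [] v * NT (fun s => p (v :: s)) eos t := NT_succ p eos t
      _ ≤ ∑ v ∈ Finset.univ.erase eos, p [] v * c ^ t :=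
        Finset.sum_le_sum fun v _ => mul_le_mul_of_nonneg_left
          (ih (fun s => hp (v :: s)) (fun s => hc (v :: s))) (hp [] v)
      _ = (∑ v ∈ Finset.univ.erase eos, p [] v) * c ^ t := (Finset.sum_mul ..).symm
      _ ≤ c * c ^ t := mul_le_mul_of_nonneg_right (hc []) (pow_nonneg hc0 t)
      _ = c ^ (t + 1) := (pow_succ' c t).symm

/-- Consistent top-k / consistent nucleus sampling is consistent with respect to any
consistent model: if `p` is a sequence model with `p s eos ≥ ξ > 0` for every prefix,
`S` is any prefix-dependent candidate-set function with `eos ∈ S s`, and `q` is `p`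
restricted to `S s` and renormalized at each step, then `q` is a sequence model with
`q s eos ≥ p s eos`, and `NT_q(t) ≤ (1 - ξ)^t → 0`. -/
theorem stmt_13 {V : Type*} [Fintype V] [DecidableEq V] (eos : V)
    (p : List V → V → ℝ)
    (hp0 : ∀ s v, 0 ≤ p s v) (hp1 : ∀ s : List V, ∑ v, p s v = 1)
    (ξ : ℝ) (hξ : 0 < ξ) (heos : ∀ s : List V, ξ ≤ p s eos)
    (S : List V → Finset V) (hS : ∀ s, eos ∈ S s)
    (q : List V → V → ℝ)
    (hq : ∀ s v, q s v = if v ∈ S s then p s v / ∑ w ∈ S s, p s w else 0) :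
    ((∀ s v, 0 ≤ q s v) ∧ (∀ s : List V, ∑ v, q s v = 1)) ∧
      (∀ s : List V, p s eos ≤ q s eos) ∧
      (∀ t : ℕ, NT q eos t ≤ (1 - ξ) ^ t) ∧
      Tendsto (fun t => NT q eos t) atTop (nhds 0) := by
  have hpos : ∀ s, 0 < ∑ w ∈ S s, p s w := fun s =>
    (hξ.trans_le (heos s)).trans_le (Finset.single_le_sum (fun v _ => hp0 s v) (hS s))
  have hle : ∀ s, ∑ w ∈ S s, p s w ≤ 1 := fun s =>
    (Finset.sum_le_univ_sum_of_nonneg (hp0 s)).trans_eq (hp1 s)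
  have hq0 : ∀ s v, 0 ≤ q s v := by
    intro s v
    rw [hq]
    split_ifs
    · exact div_nonneg (hp0 s v) (hpos s).le
    · exact le_rfl
  have hq1 : ∀ s : List V, ∑ v, q s v = 1 := by
    intro s
    simp only [hq, Finset.sum_ite_mem, Finset.univ_inter]
    rw [← Finset.sum_div, div_self (hpos s).ne']
  have hqe : ∀ s : List V, p s eos ≤ q s eos := by
    intro s
    rw [hq, if_pos (hS s)]
    exact le_div_self (hp0 s eos) (hpos s) (hle s)
  have hrest : ∀ s, ∑ v ∈ Finset.univ.erase eos, q s v ≤ 1 - ξ := by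
    intro s
    have h := Finset.add_sum_erase Finset.univ (q s) (Finset.mem_univ eos)
    linarith [hq1 s, heos s, hqe s]
  have hNT : ∀ t : ℕ, NT q eos t ≤ (1 - ξ) ^ t := NT_le_pow hq0 hrest
  have hξ1 : 0 ≤ 1 - ξ := (Finset.sum_nonneg fun v _ => hq0 [] v).trans (hrest [])
  exact ⟨⟨hq0, hq1⟩, hqe, hNT, squeeze_zero (NT_nonneg hq0 eos) hNT
    (tendsto_pow_atTop_nhds_zero_of_lt_one hξ1 (by linarith))⟩
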